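/- arXiv:2511.10718 — 2 statements merged into one kernel-verified Lean document; each statement's English description precedes it below -/
import Mathlib

section
/- Under the market model with the strong concavity assumption, there exists a Nash equilibrium: a price vector p* ∈ 𝒫 such that for every seller i and every q ∈ 𝒫_i, rev_i(q | p*) ≤ rev_i(p*_i | p*). -/
open Set

/-- Seller `i`'s expected revenue when they post price `q` and the joint price
vector is `p` with the `i`-th entry replaced by `q`. -/
noncomputable def rev {ι : Type*} [Fintype ι] [DecidableEq ι]
    (μ : ℝ → ℝ) (θ : ι → ℝ) (i : ι) (q : ℝ) (p : ι → ℝ) : ℝ :=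
  q * μ (∑ j, θ j * Function.update p i q j)

lemma det_interp {E : Type*} [NormedAddCommGroup E] [InnerProductSpace ℝ E]
    [FiniteDimensional ℝ E] (v : ℕ → ℝ) (hv : Function.Injective v) (A : E →L[ℝ] E) :
    (ContinuousLinearMap.id ℝ E + A).det =
      ∑ k ∈ Finset.range (Module.finrank ℝ E + 1),
        (Lagrange.basis (Finset.range (Module.finrank ℝ E + 1)) v k).eval 1 *
          (ContinuousLinearMap.id ℝ E + v k • A).det := by
  classical
  set b := Module.finBasis ℝ E
  set M := LinearMap.toMatrix b b (A : E →ₗ[ℝ] E) with hM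
  set P : Polynomial ℝ := Matrix.det ((Polynomial.X : Polynomial ℝ) •
    M.map Polynomial.C + (1 : Matrix _ _ ℝ).map Polynomial.C) with hP
  have hev : ∀ t : ℝ, (ContinuousLinearMap.id ℝ E + t • A).det = P.eval t := by
    intro t
    rw [ContinuousLinearMap.det, ← LinearMap.det_toMatrix b, hP, ← Polynomial.coe_evalRingHom,
      RingHom.map_det]
    congr 1
    ext i j
    simp only [hM, LinearMap.toMatrix_apply, RingHom.mapMatrix_apply, Matrix.map_apply,
      Matrix.add_apply, Matrix.smul_apply, Matrix.one_apply]
    by_cases hij : i = j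
    · subst hij
      simp
      ring
    · simp [hij]
      ring
  have hdeg : P.degree < (Finset.range (Module.finrank ℝ E + 1)).card := by
    have h1 := Polynomial.natDegree_det_X_add_C_le M 1
    rw [Fintype.card_fin] at h1
    rw [Finset.card_range]
    refine lt_of_le_of_lt Polynomial.degree_le_natDegree ?_
    exact_mod_cast Nat.lt_succ_of_le h1
  have h := Lagrange.eq_interpolate (s := Finset.range (Module.finrank ℝ E + 1)) (v := v)
    hv.injOn hdeg
  have h1 := hev 1
  rw [one_smul] at h1
  have h2 := congrArg (Polynomial.eval 1) h
  rw [Lagrange.interpolate_apply, Polynomial.eval_finsetSum] at h2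
  rw [h1, h2]
  refine Finset.sum_congr rfl fun k _ => ?_
  rw [hev, Polynomial.eval_mul, Polynomial.eval_C, mul_comm]

lemma det_pos_of_small {E : Type*} [NormedAddCommGroup E] [InnerProductSpace ℝ E]
    [FiniteDimensional ℝ E] (A : E →L[ℝ] E) (hA : ‖A‖ < 1) :
    0 < (ContinuousLinearMap.id ℝ E + A).det := by
  have hne : ∀ t ∈ Icc (0:ℝ) 1, (ContinuousLinearMap.id ℝ E + t • A).det ≠ 0 := by
    intro t ht h0
    have hb : ∃ x : E, x ≠ 0 ∧ (ContinuousLinearMap.id ℝ E + t • A) x = 0 := by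
      have := LinearMap.bot_lt_ker_of_det_eq_zero (f := ((ContinuousLinearMap.id ℝ E + t • A : E →L[ℝ] E) : E →ₗ[ℝ] E)) h0
      obtain ⟨x, hx, hx0⟩ := (Submodule.ne_bot_iff _).1 this.ne'
      exact ⟨x, hx0, by simpa using hx⟩
    obtain ⟨x, hx0, hx⟩ := hb
    have h1 : x = -(t • A x) := by
      simp at hx
      exact eq_neg_of_add_eq_zero_left hx
    have h2 : ‖x‖ ≤ ‖A‖ * ‖x‖ := by
      calc ‖x‖ = ‖-(t • A x)‖ := by rw [← h1]
        _ = |t| * ‖A x‖ := by rw [norm_neg, norm_smul, Real.norm_eq_abs]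
        _ ≤ 1 * (‖A‖ * ‖x‖) := by
          gcongr
          · rw [abs_of_nonneg ht.1]; exact ht.2
          · exact A.le_opNorm x
        _ = _ := one_mul _
    have h3 : 0 < ‖x‖ := norm_pos_iff.2 hx0
    nlinarith
  have hc : Continuous fun t : ℝ => (ContinuousLinearMap.id ℝ E + t • A).det :=
    ContinuousLinearMap.continuous_det.comp (by fun_prop)
  by_contra hneg
  push Not at hneg
  have := intermediate_value_Icc' (zero_le_one' ℝ) hc.continuousOn
  have h0 : (0:ℝ) ∈ Icc (ContinuousLinearMap.id ℝ E + (1:ℝ) • A).det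
      (ContinuousLinearMap.id ℝ E + (0:ℝ) • A).det := by
    constructor
    · simpa using hneg
    · simp [ContinuousLinearMap.det]
  obtain ⟨t, ht, h⟩ := this h0
  exact hne t ht h

open MeasureTheory in
lemma no_retraction {E : Type*} [NormedAddCommGroup E] [InnerProductSpace ℝ E]
    [FiniteDimensional ℝ E] (r : E → E)
    (hr : ∀ x ∈ Metric.closedBall (0:E) 1, ContDiffAt ℝ 1 r x)
    (hn : ∀ x ∈ Metric.closedBall (0:E) 1, ‖r x‖ = 1)
    (hid : ∀ x : E, ‖x‖ = 1 → r x = x) : False := by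
  borelize E
  set μ : Measure E := Measure.addHaar
  set A : E → (E →L[ℝ] E) := fun x => fderiv ℝ r x - ContinuousLinearMap.id ℝ E with hA
  have hAc : ContinuousOn A (Metric.closedBall 0 1) := fun x hx =>
    (((hr x hx).continuousAt_fderiv one_ne_zero).sub continuousAt_const).continuousWithinAt
  obtain ⟨K, hK⟩ := (isCompact_closedBall (0:E) 1).exists_bound_of_continuousOn hAc
  have hK0 : 0 ≤ K := (norm_nonneg _).trans (hK 0 (by simp))
  have hder : ∀ x ∈ Metric.closedBall (0:E) 1, HasFDerivAt (fun y => r y - y) (A x) x :=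
    fun x hx => ((hr x hx).differentiableAt one_ne_zero).hasFDerivAt.sub (hasFDerivAt_id x)
  set g : E → E := fun x => if ‖x‖ ≤ 1 then r x - x else 0 with hg
  have hgin : ∀ x, ‖x‖ ≤ 1 → g x = r x - x := fun x hx => by simp [hg, hx]
  have hgout : ∀ x, 1 ≤ ‖x‖ → g x = 0 := by
    intro x hx
    rcases hx.eq_or_lt with h | h
    · rw [hgin x h.symm.le, hid x h.symm, sub_self]
    · simp [hg, not_le.2 h]
  have hL1 : ∀ x y, ‖x‖ ≤ 1 → ‖y‖ ≤ 1 → ‖g x - g y‖ ≤ K * ‖x - y‖ := by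
    intro x y hx hy
    rw [hgin x hx, hgin y hy]
    exact (convex_closedBall (0:E) 1).norm_image_sub_le_of_norm_hasFDerivWithin_le
      (f := fun y => r y - y) (f' := A)
      (fun z hz => (hder z hz).hasFDerivWithinAt) hK (by simpa using hy) (by simpa using hx)
  have hL2 : ∀ x y, ‖x‖ ≤ 1 → 1 ≤ ‖y‖ → ‖g x - g y‖ ≤ K * ‖x - y‖ := by
    intro x y hx hy
    have hc : Continuous fun s : ℝ => ‖x + s • (y - x)‖ := by fun_prop
    obtain ⟨s, hs, hs1⟩ := intermediate_value_Icc (zero_le_one' ℝ) hc.continuousOn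
      (show (1:ℝ) ∈ _ by simpa using ⟨hx, hy⟩)
    simp only at hs1
    have h1 := hL1 x (x + s • (y - x)) hx hs1.le
    rw [hgout _ hs1.ge] at h1
    rw [hgout _ hy]
    refine h1.trans ?_
    gcongr
    rw [sub_add_cancel_left, norm_neg, norm_smul, Real.norm_eq_abs, abs_of_nonneg hs.1,
      norm_sub_rev y x]
    exact mul_le_of_le_one_left (norm_nonneg _) hs.2
  have hL : ∀ x y, ‖g x - g y‖ ≤ K * ‖x - y‖ := by
    intro x y
    rcases le_total ‖x‖ 1 with hx | hx <;> rcases le_total ‖y‖ 1 with hy | hy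
    · exact hL1 x y hx hy
    · exact hL2 x y hx hy
    · rw [norm_sub_rev, norm_sub_rev x]; exact hL2 y x hy hx
    · rw [hgout x hx, hgout y hy]; simp; positivity
  -- the volume identity for small t
  have hvol : ∀ t : ℝ, 0 ≤ t → t < 1 → t * K < 1 →
      ∫ x in Metric.ball (0:E) 1, (ContinuousLinearMap.id ℝ E + t • A x).det ∂μ
        = μ.real (Metric.ball (0:E) 1) := by
    intro t ht0 ht1 htK
    have hinj : InjOn (fun x => x + t • g x) (Metric.ball (0:E) 1) := by
      intro x _ y _ hxy
      simp only at hxy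
      have h1 : x - y = - (t • (g x - g y)) := by
        rw [smul_sub, neg_sub, sub_eq_sub_iff_add_eq_add, hxy]; abel
      have h2 : ‖x - y‖ ≤ t * (K * ‖x - y‖) := by
        calc ‖x - y‖ = t * ‖g x - g y‖ := by
              rw [h1, norm_neg, norm_smul, Real.norm_eq_abs, abs_of_nonneg ht0]
          _ ≤ _ := by gcongr; exact hL x y
      have h3 : ‖x - y‖ = 0 := by
        have := norm_nonneg (x - y)
        nlinarith
      exact sub_eq_zero.1 (norm_eq_zero.1 h3)
    have himg : (fun x => x + t • g x) '' (Metric.ball (0:E) 1) = Metric.ball (0:E) 1 := by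
      apply Subset.antisymm
      · rintro _ ⟨x, hx, rfl⟩
        have hx' : ‖x‖ < 1 := by simpa using hx
        have h1 := hn x (by simpa using hx'.le)
        simp only [mem_ball_zero_iff]
        rw [hgin x hx'.le]
        have : x + t • (r x - x) = (1 - t) • x + t • r x := by module
        rw [this]
        calc _ ≤ ‖(1 - t) • x‖ + ‖t • r x‖ := norm_add_le _ _
          _ = (1 - t) * ‖x‖ + t * 1 := by
            rw [norm_smul, norm_smul, h1, Real.norm_eq_abs, Real.norm_eq_abs,
              abs_of_nonneg ht0, abs_of_nonneg (by linarith)]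
          _ < 1 := by nlinarith
      · intro y hy
        have hy' : ‖y‖ < 1 := by simpa using hy
        have hcon : ContractingWith ⟨t * K, by positivity⟩ (fun x => y - t • g x) := by
          refine ⟨by exact_mod_cast htK, LipschitzWith.of_dist_le_mul fun a b => ?_⟩
          rw [dist_eq_norm, dist_eq_norm]
          have : y - t • g a - (y - t • g b) = -(t • (g a - g b)) := by module
          rw [this, norm_neg, norm_smul, Real.norm_eq_abs, abs_of_nonneg ht0]
          change _ ≤ t * K * _
          rw [mul_assoc]
          gcongr
          exact hL a b
        have hfix := hcon.fixedPoint_isFixedPt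
        set x := ContractingWith.fixedPoint _ hcon
        have hfix' : y - t • g x = x := hfix
        refine ⟨x, ?_, ?_⟩
        · by_contra hx
          have hx' : 1 ≤ ‖x‖ := by simpa using hx
          rw [hgout x hx', smul_zero, sub_zero] at hfix'
          rw [← hfix'] at hx'
          linarith
        · simp only
          nth_rewrite 1 [← hfix']
          abel
    have hd : ∀ x ∈ Metric.ball (0:E) 1, HasFDerivWithinAt (fun x => x + t • g x)
        (ContinuousLinearMap.id ℝ E + t • A x) (Metric.ball (0:E) 1) x := by
      intro x hx
      have h1 : HasFDerivAt (fun x => x + t • (r x - x))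
        (ContinuousLinearMap.id ℝ E + t • A x) x :=
        (hasFDerivAt_id x).add ((hder x (Metric.ball_subset_closedBall hx)).const_smul t)
      refine h1.hasFDerivWithinAt.congr ?_ ?_
      · intro z hz
        beta_reduce
        rw [hgin z (by simpa using (mem_ball_zero_iff.1 hz).le)]
      · rw [hgin x (by simpa using (mem_ball_zero_iff.1 hx).le)]
    have key := integral_image_eq_integral_abs_det_fderiv_smul μ
      (measurableSet_ball) hd hinj (fun _ => (1:ℝ))
    rw [himg] at key
    simp only [integral_const, smul_eq_mul, mul_one, measureReal_restrict_apply_univ] at key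
    rw [key]
    refine setIntegral_congr_fun measurableSet_ball fun x hx => ?_
    rw [abs_of_pos]
    apply det_pos_of_small
    rw [norm_smul, Real.norm_eq_abs, abs_of_nonneg ht0]
    refine lt_of_le_of_lt ?_ htK
    gcongr
    exact hK x (Metric.ball_subset_closedBall hx)
  -- interpolation
  set v : ℕ → ℝ := fun k => 1 / ((k:ℝ) + 2 + K) with hv
  have hvinj : Function.Injective v := by
    intro k l h
    simp only [hv, one_div, inv_inj] at h
    have : (k:ℝ) = l := by linarith
    exact_mod_cast this
  have hv0 : ∀ k, 0 ≤ v k := fun k => by positivity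
  have hv1 : ∀ k, v k < 1 := fun k => by
    rw [hv]; simp only
    rw [div_lt_one (by positivity)]
    have : (0:ℝ) ≤ k := by positivity
    linarith
  have hvK : ∀ k, v k * K < 1 := fun k => by
    rw [hv]; simp only
    rw [one_div_mul_eq_div, div_lt_one (by positivity)]
    have : (0:ℝ) ≤ k := by positivity
    linarith
  have hint : ∀ t : ℝ, IntegrableOn (fun x => (ContinuousLinearMap.id ℝ E + t • A x).det)
      (Metric.ball (0:E) 1) μ := by
    intro t
    have : ContinuousOn (fun x => (ContinuousLinearMap.id ℝ E + t • A x).det)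
      (Metric.closedBall (0:E) 1) :=
      ContinuousLinearMap.continuous_det.comp_continuousOn
        (continuousOn_const.add (hAc.const_smul t))
    exact (this.integrableOn_compact (isCompact_closedBall _ _)).mono_set
      Metric.ball_subset_closedBall
  have hfin : ∫ x in Metric.ball (0:E) 1, (ContinuousLinearMap.id ℝ E + A x).det ∂μ
        = μ.real (Metric.ball (0:E) 1) := by
    rw [integral_congr_ae (ae_of_all _ fun x => det_interp v hvinj (A x))]
    rw [integral_finsetSum _ fun k _ => (hint (v k)).const_mul _]
    simp_rw [integral_const_mul, hvol _ (hv0 _) (hv1 _) (hvK _)]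
    rw [← Finset.sum_mul, ← Polynomial.eval_finsetSum, Lagrange.sum_basis hvinj.injOn (by simp)]
    simp
  have hzero : ∫ x in Metric.ball (0:E) 1, (ContinuousLinearMap.id ℝ E + A x).det ∂μ = 0 := by
    refine setIntegral_eq_zero_of_forall_eq_zero fun x hx => ?_
    have hxc := Metric.ball_subset_closedBall hx
    have e1 : ContinuousLinearMap.id ℝ E + A x = fderiv ℝ r x := by simp [hA]
    rw [e1]
    by_contra hne
    have hD := ((hr x hxc).differentiableAt one_ne_zero).hasFDerivAt
    have h1 := hD.norm_sq
    have h2 : HasFDerivAt (fun y => ‖r y‖ ^ 2) (0 : E →L[ℝ] ℝ) x := by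
      refine (hasFDerivAt_const (1:ℝ) x).congr_of_eventuallyEq ?_
      filter_upwards [Metric.isOpen_ball.mem_nhds hx] with y hy
      rw [hn y (Metric.ball_subset_closedBall hy)]; norm_num
    have h3 := h1.unique h2
    have hsurj : Function.Surjective (fderiv ℝ r x) := by
      have := LinearMap.equivOfDetNeZero (fderiv ℝ r x : E →ₗ[ℝ] E) hne
      exact (LinearMap.equivOfDetNeZero (fderiv ℝ r x : E →ₗ[ℝ] E) hne).surjective
    obtain ⟨w, hw⟩ := hsurj (r x)
    have h4 := DFunLike.congr_fun h3 w
    simp [hw] at h4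
    have h5 := hn x hxc
    rw [h4] at h5
    simp at h5
  rw [hzero] at hfin
  have : 0 < μ.real (Metric.ball (0:E) 1) :=
    ENNReal.toReal_pos (Metric.measure_ball_pos μ _ one_pos).ne' measure_ball_lt_top.ne
  linarith

lemma brouwer_half {E : Type*} [NormedAddCommGroup E] [InnerProductSpace ℝ E]
    [FiniteDimensional ℝ E] (f : E → E) (hf : Continuous f) (hb : ∀ x, ‖f x‖ ≤ 1 / 2) :
    ∃ x, f x = x := by
  by_contra hno
  push Not at hno
  obtain ⟨x0, -, hx0⟩ := (isCompact_closedBall (0:E) 1).exists_isMinOn ⟨0, by simp⟩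
    (f := fun x => ‖f x - x‖) (by fun_prop)
  set δ := ‖f x0 - x0‖ with hδ
  have hδ0 : 0 < δ := norm_pos_iff.2 (sub_ne_zero.2 (hno x0))
  obtain ⟨p, hp, hpd, -⟩ := hf.exists_contDiff_approx (ε := fun _ => min δ (1/2)) 1
    continuous_const (fun _ => by positivity)
  have hp1 : ∀ x, ‖p x‖ < 1 := by
    intro x
    have h1 := (hpd x).trans_le (min_le_right _ _)
    rw [dist_eq_norm] at h1
    have := norm_le_norm_add_norm_sub' (p x) (f x)
    linarith [hb x]
  have hpx : ∀ x, ‖x‖ ≤ 1 → x - p x ≠ 0 := by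
    intro x hx h
    have h1 := (hpd x).trans_le (min_le_left _ _)
    rw [← sub_eq_zero.1 h, dist_comm, dist_eq_norm] at h1
    have : δ ≤ ‖f x - x‖ := hx0 (show x ∈ Metric.closedBall (0:E) 1 by simpa using hx)
    linarith
  have hp' : ContDiff ℝ 1 p := by exact_mod_cast hp
  set B : E → ℝ := fun x => inner ℝ x (x - p x) with hB
  set N : E → ℝ := fun x => ‖x - p x‖ ^ 2 with hN
  set D : E → ℝ := fun x => B x ^ 2 + N x * (1 - ‖x‖ ^ 2) with hD
  have hNpos : ∀ x, ‖x‖ ≤ 1 → 0 < N x := fun x hx => by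
    have := norm_pos_iff.2 (hpx x hx)
    positivity
  have hBpos : ∀ x, ‖x‖ = 1 → 0 < B x := by
    intro x hx
    simp only [hB, inner_sub_right, real_inner_self_eq_norm_sq, hx]
    have := real_inner_le_norm x (p x)
    rw [hx] at this
    linarith [hp1 x]
  have hDpos : ∀ x, ‖x‖ ≤ 1 → 0 < D x := by
    intro x hx
    rcases hx.eq_or_lt with h | h
    · have := hBpos x h
      simp only [hD, h]
      norm_num
      positivity
    · have h1 := hNpos x hx
      have h2 : 0 < 1 - ‖x‖ ^ 2 := by nlinarith [norm_nonneg x]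
      have := mul_pos h1 h2
      simp only [hD]
      positivity
  have hBc : ContDiff ℝ 1 B := contDiff_id.inner ℝ (contDiff_id.sub hp')
  have hNc : ContDiff ℝ 1 N := (contDiff_id.sub hp').norm_sq ℝ
  have hDc : ContDiff ℝ 1 D := (hBc.pow 2).add (hNc.mul (contDiff_const.sub (contDiff_id.norm_sq ℝ)))
  refine no_retraction (fun x => x + ((-B x + √(D x)) / N x) • (x - p x)) ?_ ?_ ?_
  · intro x hx
    have hx' : ‖x‖ ≤ 1 := by simpa using hx
    exact contDiffAt_id.add (((hBc.contDiffAt.neg.add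
      (hDc.contDiffAt.sqrt (hDpos x hx').ne')).div hNc.contDiffAt (hNpos x hx').ne').smul
      (contDiffAt_id.sub hp'.contDiffAt))
  · intro x hx
    have hx' : ‖x‖ ≤ 1 := by simpa using hx
    have hs := Real.sq_sqrt (hDpos x hx').le
    have hN0 := (hNpos x hx').ne'
    rw [← sq_eq_sq₀ (norm_nonneg _) zero_le_one, norm_add_sq_real, real_inner_smul_right,
      norm_smul, mul_pow, Real.norm_eq_abs, sq_abs]
    change ‖x‖ ^ 2 + 2 * ((-B x + √(D x)) / N x * B x) + ((-B x + √(D x)) / N x) ^ 2 * N x = 1 ^ 2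
    set S := √(D x)
    have hs' : S ^ 2 = B x ^ 2 + N x * (1 - ‖x‖ ^ 2) := hs
    field_simp
    linear_combination hs'
  · intro x hx
    have : √(D x) = B x := by
      have : D x = B x ^ 2 := by simp [hD, hx]
      rw [this, Real.sqrt_sq (hBpos x hx).le]
    simp [this]

lemma brouwer_bdd {E : Type*} [NormedAddCommGroup E] [InnerProductSpace ℝ E]
    [FiniteDimensional ℝ E] (f : E → E) (hf : Continuous f) (R : ℝ) (hb : ∀ x, ‖f x‖ ≤ R) :
    ∃ x, f x = x := by
  have hR : 0 ≤ R := (norm_nonneg _).trans (hb 0)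
  set c : ℝ := 2 * (R + 1) with hc
  have hc0 : 0 < c := by positivity
  obtain ⟨x, hx⟩ := brouwer_half (fun x => c⁻¹ • f (c • x)) (by fun_prop) (by
    intro x
    rw [norm_smul, norm_inv, Real.norm_eq_abs, abs_of_pos hc0, inv_mul_le_iff₀ hc0]
    linarith [hb (c • x)])
  refine ⟨c • x, ?_⟩
  nth_rewrite 2 [← hx]
  rw [smul_inv_smul₀ hc0.ne']

/-- Brouwer on a box, in the form used for the equilibrium. -/
lemma brouwer_box {ι : Type*} [Fintype ι] (a b : ι → ℝ) (hab : ∀ i, a i ≤ b i)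
    (d : (ι → ℝ) → (ι → ℝ)) (hd : Continuous d) :
    ∃ p : ι → ℝ, (∀ i, p i ∈ Icc (a i) (b i)) ∧
      ∀ i, max (a i) (min (b i) (p i + d p i)) = p i := by
  set T : (ι → ℝ) → (ι → ℝ) := fun p i => max (a i) (min (b i) (p i + d p i)) with hT
  have hTc : Continuous T := by
    refine continuous_pi fun i => ?_
    have := (continuous_apply i).comp hd
    simp only [hT]
    exact continuous_const.max (continuous_const.min ((continuous_apply i).add this))
  have hTm : ∀ p i, T p i ∈ Icc (a i) (b i) := fun p i =>
    ⟨le_max_left _ _, max_le (hab i) (min_le_left _ _)⟩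
  have hcpt : IsCompact (WithLp.toLp 2 '' (Set.pi univ fun i => Icc (a i) (b i)) :
      Set (EuclideanSpace ℝ ι)) :=
    (isCompact_univ_pi fun i => isCompact_Icc).image (PiLp.continuous_toLp 2 _)
  obtain ⟨R, hR⟩ := hcpt.isBounded.exists_norm_le
  obtain ⟨x, hx⟩ := brouwer_bdd (E := EuclideanSpace ℝ ι)
    (fun x => WithLp.toLp 2 (T (WithLp.ofLp x)))
    ((PiLp.continuous_toLp 2 _).comp (hTc.comp (PiLp.continuous_ofLp 2 _))) R
    (fun x => hR _ ⟨_, fun i _ => hTm _ i, rfl⟩)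
  have hx' : T (WithLp.ofLp x) = WithLp.ofLp x := congrArg WithLp.ofLp hx
  refine ⟨WithLp.ofLp x, fun i => ?_, fun i => congrFun hx' i⟩
  rw [← hx']
  exact hTm _ i

lemma tangent_of_concave (φ : ℝ → ℝ) (D x q : ℝ) (hφ : HasDerivAt φ D x)
    (h : ∀ t ∈ Icc (0:ℝ) 1, t * φ q + (1 - t) * φ x ≤ φ (t * q + (1 - t) * x)) :
    φ q - φ x ≤ D * (q - x) := by
  have h1 : HasDerivAt (fun t : ℝ => x + t * (q - x)) (q - x) 0 := by
    simpa using ((hasDerivAt_id (0:ℝ)).mul_const (q - x)).const_add x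
  have hφ' : HasDerivAt φ D (x + 0 * (q - x)) := by simpa using hφ
  have h2 : HasDerivAt (fun t : ℝ => φ (x + t * (q - x))) (D * (q - x)) 0 :=
    HasDerivAt.comp (0:ℝ) hφ' h1
  refine ge_of_tendsto h2.tendsto_slope_zero_right ?_
  filter_upwards [Ioo_mem_nhdsGT (zero_lt_one' ℝ)] with t ht
  have h3 := h t ⟨ht.1.le, ht.2.le⟩
  have e : t * q + (1 - t) * x = x + t * (q - x) := by ring
  rw [e] at h3
  simp only [zero_add, zero_mul, add_zero, smul_eq_mul]
  rw [le_inv_mul_iff₀ ht.1]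
  linarith

theorem stmt_5 {ι : Type*} [Fintype ι] [DecidableEq ι] [Nonempty ι]
    (a b : ι → ℝ) (ha : ∀ i, 0 ≤ a i) (hab : ∀ i, a i < b i)
    (θ : ι → ι → ℝ) (β : ι → ℝ) (hβ : ∀ i, 0 < β i) (hθ : ∀ i, θ i i = -β i)
    (μ : ι → ℝ → ℝ) (hμ : ∀ i, ContDiff ℝ 2 (μ i))
    (hμpos : ∀ i u, 0 < μ i u) (hμ' : ∀ i u, 0 < deriv (μ i) u)
    (hconc : ∀ i, ∃ ξ > (0 : ℝ), ∀ p : ι → ℝ, (∀ j, p j ∈ Icc (a j) (b j)) →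
      ∀ x ∈ Icc (a i) (b i), ∀ y ∈ Icc (a i) (b i), ∀ t ∈ Icc (0 : ℝ) 1,
        t * rev (μ i) (θ i) i x p + (1 - t) * rev (μ i) (θ i) i y p
            + ξ / 2 * t * (1 - t) * (x - y) ^ 2
          ≤ rev (μ i) (θ i) i (t * x + (1 - t) * y) p) :
    ∃ pstar : ι → ℝ, (∀ j, pstar j ∈ Icc (a j) (b j)) ∧
      ∀ i, ∀ q ∈ Icc (a i) (b i),
        rev (μ i) (θ i) i q pstar ≤ rev (μ i) (θ i) i (pstar i) pstar := by
  set u : ι → (ι → ℝ) → ℝ := fun i p => ∑ j, θ i j * p j with hu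
  have huc : ∀ i, Continuous (u i) := fun i => by simp only [hu]; fun_prop
  have hdc : ∀ i, Continuous (deriv (μ i)) := fun i => (hμ i).continuous_deriv (by norm_num)
  obtain ⟨p, hp, hfix⟩ := brouwer_box a b (fun i => (hab i).le)
    (fun p i => μ i (u i p) - β i * p i * deriv (μ i) (u i p))
    (continuous_pi fun i => (((hμ i).continuous.comp (huc i))).sub
      ((continuous_const.mul (continuous_apply i)).mul ((hdc i).comp (huc i))))
  refine ⟨p, hp, fun i q hq => ?_⟩
  have hup : ∀ x, ∑ j, θ i j * Function.update p i x j = u i p + -β i * (x - p i) := by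
    intro x
    have : ∀ j, θ i j * Function.update p i x j
        = θ i j * p j + if j = i then -β i * (x - p i) else 0 := by
      intro j
      by_cases hj : j = i
      · subst hj
        simp [hθ]
        ring
      · simp [hj]
    simp_rw [this, Finset.sum_add_distrib]
    simp [hu]
  have hder : HasDerivAt (fun x => rev (μ i) (θ i) i x p)
      (μ i (u i p) - β i * p i * deriv (μ i) (u i p)) (p i) := by
    simp only [rev, hup]
    have h1 : HasDerivAt (fun x => u i p + -β i * (x - p i)) (-β i) (p i) := by
      simpa using (((hasDerivAt_id (p i)).sub_const (p i)).const_mul (-β i)).const_add (u i p)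
    have h2 : HasDerivAt (μ i) (deriv (μ i) (u i p)) (u i p + -β i * (p i - p i)) := by
      simpa using ((hμ i).differentiable (by norm_num) (u i p)).hasDerivAt
    have h3 := (hasDerivAt_id (p i)).mul (HasDerivAt.comp (p i) h2 h1)
    refine HasDerivAt.congr_deriv (show HasDerivAt (fun x => x * μ i (u i p + -β i * (x - p i))) _ _ from h3) ?_
    simp only [id, Function.comp, sub_self, mul_zero, add_zero, one_mul]
    ring
  obtain ⟨ξ, hξ, hc⟩ := hconc i
  have htan := tangent_of_concave _ _ (p i) q hder (by
    intro t ht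
    have h := hc p hp q hq (p i) (hp i) t ht
    have h0 : 0 ≤ ξ / 2 * t * (1 - t) * (q - p i) ^ 2 := by
      have := ht.1
      have : 0 ≤ 1 - t := by linarith [ht.2]
      positivity
    linarith)
  have hf := hfix i
  set D := μ i (u i p) - β i * p i * deriv (μ i) (u i p)
  have hD : D * (q - p i) ≤ 0 := by
    rcases lt_trichotomy D 0 with h | h | h
    · have : p i ≤ a i := by
        by_contra hlt
        push Not at hlt
        have : max (a i) (min (b i) (p i + D)) < p i :=
          max_lt hlt (lt_of_le_of_lt (min_le_right _ _) (by linarith))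
        exact absurd hf this.ne
      exact mul_nonpos_of_nonpos_of_nonneg h.le (by linarith [hq.1])
    · simp [h]
    · have : b i ≤ p i := by
        by_contra hlt
        push Not at hlt
        have : p i < max (a i) (min (b i) (p i + D)) :=
          lt_max_of_lt_right (lt_min hlt (by linarith))
        exact absurd hf this.ne'
      exact mul_nonpos_of_nonneg_of_nonpos h.le (by linarith [hq.2])
  linarith
end

section
/- Fix N ≥ 1, vectors p⁽¹⁾, …, p⁽ⁿ⁾ ∈ ℝ^N, a constant λ > 0, and a continuously differentiable function μ : ℝ → ℝ with c ≤ μ′(u) ≤ L for all u ∈ ℝ, where 0 < c ≤ L. Define g(θ) = ∑_{s=1}^n μ(⟨p⁽ˢ⁾, θ⟩)·p⁽ˢ⁾ + λθ and V = ∑_{s=1}^n p⁽ˢ⁾ p⁽ˢ⁾ᵀ + (λ/c) I_N. Then for all θ₀, θ₁, x ∈ ℝ^N, |μ(⟨x, θ₀⟩) − μ(⟨x, θ₁⟩)| ≤ (L/c) · ‖x‖_{V⁻¹} · ‖g(θ₀) − g(θ₁)‖_{V⁻¹}. -/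
open Matrix

lemma cs_aux {N : ℕ} (V : Matrix (Fin N) (Fin N) ℝ) (hV : V.PosDef) (x d : Fin N → ℝ) :
    |x ⬝ᵥ d| ≤ Real.sqrt (x ⬝ᵥ (V⁻¹ *ᵥ x)) * Real.sqrt (d ⬝ᵥ (V *ᵥ d)) := by
  have hdet : IsUnit V.det := hV.det_pos.ne'.isUnit
  have hT : Vᵀ = V := by simpa using hV.1.eq
  have hnn : ∀ z : Fin N → ℝ, 0 ≤ z ⬝ᵥ (V *ᵥ z) := fun z => by
    simpa using hV.posSemidef.dotProduct_mulVec_nonneg z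
  obtain ⟨y, rfl⟩ : ∃ y, x = V *ᵥ y :=
    ⟨V⁻¹ *ᵥ x, by rw [mulVec_mulVec, mul_nonsing_inv _ hdet, one_mulVec]⟩
  have hsym : ∀ a b : Fin N → ℝ, a ⬝ᵥ (V *ᵥ b) = b ⬝ᵥ (V *ᵥ a) := fun a b => by
    rw [dotProduct_mulVec, ← mulVec_transpose, hT, dotProduct_comm]
  rw [mulVec_mulVec, nonsing_inv_mul _ hdet, one_mulVec, dotProduct_comm (V *ᵥ y) y,
    dotProduct_comm (V *ᵥ y) d, ← Real.sqrt_mul (hnn y)]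
  apply Real.abs_le_sqrt
  have key : ∀ t : ℝ, 0 ≤ (y ⬝ᵥ (V *ᵥ y)) * (t * t) + (2 * (d ⬝ᵥ (V *ᵥ y))) * t
      + d ⬝ᵥ (V *ᵥ d) := fun t => by
    have h := hnn (t • y + d)
    simp only [mulVec_add, mulVec_smul, add_dotProduct, dotProduct_add, smul_dotProduct,
      dotProduct_smul, smul_eq_mul, hsym y d] at h
    linarith
  have := discrim_le_zero key
  unfold discrim at this
  nlinarith

theorem stmt_13 {N n : ℕ} (hN : 1 ≤ N) (p : Fin n → Fin N → ℝ)
    (l : ℝ) (hl : 0 < l) (c L : ℝ) (hc : 0 < c) (hcL : c ≤ L)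
    (μ : ℝ → ℝ) (hμ : ContDiff ℝ 1 μ)
    (hμ' : ∀ u : ℝ, c ≤ deriv μ u ∧ deriv μ u ≤ L)
    (θ₀ θ₁ x : Fin N → ℝ) :
    |μ (x ⬝ᵥ θ₀) - μ (x ⬝ᵥ θ₁)|
      ≤ (L / c) *
        Real.sqrt (x ⬝ᵥ (((∑ s, vecMulVec (p s) (p s)) + (l / c) • (1 : Matrix (Fin N) (Fin N) ℝ))⁻¹ *ᵥ x)) *
        Real.sqrt ((((∑ s, μ (p s ⬝ᵥ θ₀) • p s) + l • θ₀) - ((∑ s, μ (p s ⬝ᵥ θ₁) • p s) + l • θ₁)) ⬝ᵥ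
          (((∑ s, vecMulVec (p s) (p s)) + (l / c) • (1 : Matrix (Fin N) (Fin N) ℝ))⁻¹ *ᵥ
            (((∑ s, μ (p s ⬝ᵥ θ₀) • p s) + l • θ₀) - ((∑ s, μ (p s ⬝ᵥ θ₁) • p s) + l • θ₁)))) := by
  have hdiff : Differentiable ℝ μ := hμ.differentiable (by norm_num)
  have hlow : ∀ a b : ℝ, c * (a - b) ^ 2 ≤ (μ a - μ b) * (a - b) := by
    have h1 : ∀ a b : ℝ, a ≤ b → c * (b - a) ≤ μ b - μ a := fun a b hab =>
      mul_sub_le_image_sub_of_le_deriv hdiff (fun u => (hμ' u).1) hab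
    intro a b
    rcases le_total a b with h | h
    · nlinarith [h1 a b h]
    · nlinarith [h1 b a h]
  have hup : ∀ a b : ℝ, |μ a - μ b| ≤ L * |a - b| := by
    intro a b
    have := Convex.norm_image_sub_le_of_norm_deriv_le (f := μ) (C := L) (s := Set.univ)
      (x := b) (y := a) (fun u _ => hdiff u)
      (fun u _ => by
        rw [Real.norm_eq_abs, abs_of_nonneg (hc.le.trans (hμ' u).1)]
        exact (hμ' u).2) convex_univ trivial trivial
    simpa [Real.norm_eq_abs] using this
  have hV : ((∑ s, vecMulVec (p s) (p s)) + (l / c) • (1 : Matrix (Fin N) (Fin N) ℝ)).PosDef := by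
    apply PosDef.posSemidef_add
    · apply posSemidef_sum
      intro s _
      simpa using posSemidef_vecMulVec_self_star (p s)
    · exact PosDef.one.smul (div_pos hl hc)
  have hq : ∀ d : Fin N → ℝ, d ⬝ᵥ (((∑ s, vecMulVec (p s) (p s))
      + (l / c) • (1 : Matrix (Fin N) (Fin N) ℝ)) *ᵥ d)
      = ∑ s, (p s ⬝ᵥ d) ^ 2 + l / c * (d ⬝ᵥ d) := by
    intro d
    rw [add_mulVec, dotProduct_add, sum_mulVec, dotProduct_sum, smul_mulVec, one_mulVec,
      dotProduct_smul, smul_eq_mul]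
    congr 1
    refine Finset.sum_congr rfl fun s _ => ?_
    rw [vecMulVec_mulVec]
    simp [dotProduct_comm d (p s), sq]
  have hG : c * (∑ s, (p s ⬝ᵥ (θ₀ - θ₁)) ^ 2 + l / c * ((θ₀ - θ₁) ⬝ᵥ (θ₀ - θ₁)))
      ≤ (((∑ s, μ (p s ⬝ᵥ θ₀) • p s) + l • θ₀) - ((∑ s, μ (p s ⬝ᵥ θ₁) • p s) + l • θ₁))
        ⬝ᵥ (θ₀ - θ₁) := by
    have e : (((∑ s, μ (p s ⬝ᵥ θ₀) • p s) + l • θ₀) - ((∑ s, μ (p s ⬝ᵥ θ₁) • p s) + l • θ₁))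
        = (∑ s, (μ (p s ⬝ᵥ θ₀) - μ (p s ⬝ᵥ θ₁)) • p s) + l • (θ₀ - θ₁) := by
      simp only [sub_smul, Finset.sum_sub_distrib, smul_sub]
      abel
    rw [e, add_dotProduct, sum_dotProduct, smul_dotProduct, smul_eq_mul, mul_add, ← mul_assoc,
      mul_div_cancel₀ _ hc.ne', Finset.mul_sum]
    gcongr with s
    rw [smul_dotProduct, smul_eq_mul, dotProduct_sub]
    exact hlow _ _
  rw [← hq] at hG
  generalize (((∑ s, μ (p s ⬝ᵥ θ₀) • p s) + l • θ₀)
    - ((∑ s, μ (p s ⬝ᵥ θ₁) • p s) + l • θ₁)) = G at hG ⊢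
  generalize ((∑ s, vecMulVec (p s) (p s)) + (l / c) • (1 : Matrix (Fin N) (Fin N) ℝ)) = V
    at hG hV ⊢
  have h1 := cs_aux V hV x (θ₀ - θ₁)
  have h2 := cs_aux V hV G (θ₀ - θ₁)
  have hnn : 0 ≤ (θ₀ - θ₁) ⬝ᵥ (V *ᵥ (θ₀ - θ₁)) := by
    simpa using hV.posSemidef.dotProduct_mulVec_nonneg (θ₀ - θ₁)
  have h3 := hup (x ⬝ᵥ θ₀) (x ⬝ᵥ θ₁)
  rw [← dotProduct_sub] at h3
  have hsq := Real.sq_sqrt hnn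
  have h4 := (hG.trans (le_abs_self _)).trans h2
  rw [← hsq] at h4
  have hD := Real.sqrt_nonneg ((θ₀ - θ₁) ⬝ᵥ (V *ᵥ (θ₀ - θ₁)))
  have hX := Real.sqrt_nonneg (x ⬝ᵥ (V⁻¹ *ᵥ x))
  have hg := Real.sqrt_nonneg (G ⬝ᵥ (V⁻¹ *ᵥ G))
  rw [Real.sqrt_sq hD] at h4
  generalize Real.sqrt ((θ₀ - θ₁) ⬝ᵥ (V *ᵥ (θ₀ - θ₁))) = D at *
  generalize Real.sqrt (x ⬝ᵥ (V⁻¹ *ᵥ x)) = X at *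
  generalize Real.sqrt (G ⬝ᵥ (V⁻¹ *ᵥ G)) = g at *
  have h5 : D ≤ g / c := by
    rw [le_div_iff₀ hc]
    rcases hD.eq_or_lt with h | h
    · rw [← h]; simpa using hg
    · nlinarith
  have hL : 0 ≤ L := hc.le.trans hcL
  calc _ ≤ L * |x ⬝ᵥ (θ₀ - θ₁)| := h3
    _ ≤ L * (X * (g / c)) := by
      gcongr
      exact h1.trans (by gcongr)
    _ = _ := by ring
end
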